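/- arXiv:2204.12368 — 5 statements merged into one kernel-verified Lean document; each statement's English description precedes it below -/
import Mathlib

section
/- Let n ≥ 1 be a natural number, a : ℕ → ℕ a sequence with a 0 ≤ n, 1 ≤ a i for all i, and a (i+1) ≤ a i for all i, and let S : ℕ → Prop be a predicate such that 2 * a (i+1) ≤ a i whenever S i holds. Then for every k, the number of indices i < k with S i is at most Nat.log 2 n. -/
/-- A non-increasing sequence that halves at every index in `S` has lost a factor of two for each
such index passed. -/
theorem two_pow_card_filter_mul_le (a : ℕ → ℕ) (S : ℕ → Prop) [DecidablePred S]
    (hmono : ∀ i, a (i + 1) ≤ a i) (hhalf : ∀ i, S i → 2 * a (i + 1) ≤ a i) (k : ℕ) :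
    2 ^ ((Finset.range k).filter S).card * a k ≤ a 0 := by
  induction k with
  | zero => simp
  | succ k ih =>
    refine le_trans ?_ ih
    rw [Finset.range_add_one, Finset.filter_insert]
    split_ifs with h
    · rw [Finset.card_insert_of_notMem (by simp), pow_succ, mul_assoc]
      exact Nat.mul_le_mul_left _ (hhalf k h)
    · exact Nat.mul_le_mul_left _ (hmono k)

theorem hopcroft_trick (n : ℕ) (hn : 1 ≤ n) (a : ℕ → ℕ) (S : ℕ → Prop)
    [DecidablePred S]
    (ha0 : a 0 ≤ n) (ha1 : ∀ i, 1 ≤ a i) (hmono : ∀ i, a (i + 1) ≤ a i)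
    (hhalf : ∀ i, S i → 2 * a (i + 1) ≤ a i) :
    ∀ k : ℕ, ((Finset.range k).filter S).card ≤ Nat.log 2 n := by
  intro k
  apply Nat.le_log_of_pow_le one_lt_two
  calc 2 ^ ((Finset.range k).filter S).card
      ≤ 2 ^ ((Finset.range k).filter S).card * a k := Nat.le_mul_of_pos_right _ (ha1 k)
    _ ≤ a 0 := two_pow_card_filter_mul_le a S hmono hhalf k
    _ ≤ n := ha0
end

section
/- Let C be a nonempty finite type and p : ℕ → C → ℕ a sequence of maps such that (refinement) for all i and all x y : C, p (i+1) x = p (i+1) y implies p i x = p i y, and (largest-block reuse) for all i and all x : C, either p (i+1) x = p i x or 2 * Fintype.card {y : C // p (i+1) y = p (i+1) x} ≤ Fintype.card {y : C // p i y = p i x}. Then for every x : C and every k, the number of indices i < k with p (i+1) x ≠ p i x is at most Nat.log 2 (Fintype.card C). -/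
theorem two_pow_card_changes_mul_card_block_le {C : Type*} [Fintype C]
    (p : ℕ → C → ℕ)
    (hrefine : ∀ i, ∀ x y : C, p (i + 1) x = p (i + 1) y → p i x = p i y)
    (hreuse : ∀ i, ∀ x : C,
      p (i + 1) x = p i x ∨
      2 * Fintype.card {y : C // p (i + 1) y = p (i + 1) x} ≤
        Fintype.card {y : C // p i y = p i x})
    (x : C) (k : ℕ) :
    2 ^ ((Finset.range k).filter (fun i => p (i + 1) x ≠ p i x)).card *
      Fintype.card {y : C // p k y = p k x} ≤ Fintype.card C := by
  induction k with
  | zero => simpa using Fintype.card_subtype_le (fun y : C => p 0 y = p 0 x)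
  | succ k ih =>
    rw [Finset.range_add_one, Finset.filter_insert]
    split_ifs with hchange
    · rw [Finset.card_insert_of_notMem (by simp), pow_succ, mul_assoc]
      exact (Nat.mul_le_mul_left _ ((hreuse k x).resolve_left hchange)).trans ih
    · exact (Nat.mul_le_mul_left _
        (Fintype.card_subtype_mono _ _ fun y hy => hrefine k y x hy)).trans ih

theorem blocks_change_log_often {C : Type*} [Fintype C] [Nonempty C]
    (p : ℕ → C → ℕ)
    (hrefine : ∀ i, ∀ x y : C, p (i + 1) x = p (i + 1) y → p i x = p i y)
    (hreuse : ∀ i, ∀ x : C,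
      p (i + 1) x = p i x ∨
      2 * Fintype.card {y : C // p (i + 1) y = p (i + 1) x} ≤
        Fintype.card {y : C // p i y = p i x}) :
    ∀ (x : C) (k : ℕ),
      ((Finset.range k).filter (fun i => p (i + 1) x ≠ p i x)).card ≤
        Nat.log 2 (Fintype.card C) := by
  intro x k
  have hblock : 0 < Fintype.card {y : C // p k y = p k x} :=
    Fintype.card_pos_iff.mpr ⟨⟨x, rfl⟩⟩
  exact Nat.le_log_of_pow_le one_lt_two <| (Nat.le_mul_of_pos_right _ hblock).trans
    (two_pow_card_changes_mul_card_block_le p hrefine hreuse x k)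
end

section
/- Let C be a finite type with decidable equality and c : C → Finset C a finitely branching transition system. For all x y : C, the following are equivalent: (i) there exist a type D with decidable equality, a map d : D → Finset D, and a function h : C → D satisfying d (h z) = (c z).image h for all z : C, such that h x = h y; (ii) there exists a relation R : C → C → Prop with R x y such that for all u v : C with R u v, for every u' ∈ c u there exists v' ∈ c v with R u' v', and for every v' ∈ c v there exists u' ∈ c u with R u' v'. -/
/-- `R` is a strong bisimulation on the transition system `c`. -/
def IsBisimulation {C : Type*} (c : C → Finset C) (R : C → C → Prop) : Prop :=
  ∀ u v : C, R u v →
    (∀ u' ∈ c u, ∃ v' ∈ c v, R u' v') ∧ (∀ v' ∈ c v, ∃ u' ∈ c u, R u' v')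

/-- The kernel of a coalgebra homomorphism is a bisimulation. -/
theorem isBisimulation_ker {C D : Type*} [DecidableEq D] {c : C → Finset C}
    {d : D → Finset D} {h : C → D} (hd : ∀ z, d (h z) = (c z).image h) :
    IsBisimulation c (fun u v => h u = h v) := by
  intro u v huv
  have himage : (c u).image h = (c v).image h := by rw [← hd, ← hd, huv]
  refine ⟨fun u' hu' => ?_, fun v' hv' => ?_⟩
  · obtain ⟨v', hv', h'⟩ := Finset.mem_image.1 (himage ▸ Finset.mem_image_of_mem h hu')
    exact ⟨v', hv', h'.symm⟩
  · exact Finset.mem_image.1 (himage.symm ▸ Finset.mem_image_of_mem h hv')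

/-- Related states have the same successors modulo a bisimulation. -/
theorem IsBisimulation.image_quot_mk_eq {C : Type*} {c : C → Finset C} {R : C → C → Prop}
    [DecidableEq (Quot R)] (hR : IsBisimulation c R) {u v : C} (huv : R u v) :
    (c u).image (Quot.mk R) = (c v).image (Quot.mk R) := by
  ext q
  simp only [Finset.mem_image]
  constructor
  · rintro ⟨u', hu', rfl⟩
    obtain ⟨v', hv', h'⟩ := (hR u v huv).1 u' hu'
    exact ⟨v', hv', (Quot.sound h').symm⟩
  · rintro ⟨v', hv', rfl⟩
    obtain ⟨u', hu', h'⟩ := (hR u v huv).2 v' hv'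
    exact ⟨u', hu', Quot.sound h'⟩

theorem powerset_behavEquiv_iff_bisimilar {C : Type} [Fintype C] [DecidableEq C]
    (c : C → Finset C) (x y : C) :
    (∃ (D : Type) (_ : DecidableEq D) (d : D → Finset D) (h : C → D),
        (∀ z : C, d (h z) = (c z).image h) ∧ h x = h y) ↔
    (∃ R : C → C → Prop, R x y ∧
        ∀ u v : C, R u v →
          (∀ u' ∈ c u, ∃ v' ∈ c v, R u' v') ∧
          (∀ v' ∈ c v, ∃ u' ∈ c u, R u' v')) := by
  constructor
  · rintro ⟨D, _, d, h, hd, hxy⟩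
    exact ⟨fun u v => h u = h v, hxy, isBisimulation_ker hd⟩
  · rintro ⟨R, hxy, hR⟩
    have hR : IsBisimulation c R := hR
    classical
    exact ⟨Quot R, inferInstance,
      Quot.lift (fun z => (c z).image (Quot.mk R)) fun _ _ => hR.image_quot_mk_eq,
      Quot.mk R, fun _ => rfl, Quot.sound hxy⟩
end

section
/- Let A be a type (the alphabet), C a type, o : C → Bool, and t : C → A → C, forming a deterministic automaton, i.e., a coalgebra c = fun x => (o x, t x) for the functor F X = Bool × (A → X). Define the language map L : C → List A → Bool by L x [] = o x and L x (a :: w) = L (t x a) w. Then for all x y : C the following are equivalent: (i) there exist a type D, maps o' : D → Bool and t' : D → A → D, and a function h : C → D satisfying o' (h z) = o z and t' (h z) a = h (t z a) for all z : C and a : A, such that h x = h y; (ii) L x = L y. -/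
universe u v

/-- The language accepted from a state of a deterministic automaton. -/
def lang {A : Type u} {C : Type v} (o : C → Bool) (t : C → A → C) :
    C → List A → Bool
  | x, [] => o x
  | x, a :: w => lang o t (t x a) w

/-- Coalgebra homomorphisms preserve the accepted language. -/
theorem lang_map {A : Type*} {C D : Type*} {o : C → Bool} {t : C → A → C}
    {o' : D → Bool} {t' : D → A → D} {h : C → D}
    (ho : ∀ z, o' (h z) = o z) (ht : ∀ z a, t' (h z) a = h (t z a)) (x : C) :
    lang o' t' (h x) = lang o t x := by
  funext w
  induction w generalizing x with
  | nil => exact ho x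
  | cons a w ih => simp only [lang, ht, ih]

theorem dfa_behavEquiv_iff_lang_eq {A : Type u} {C : Type v}
    (o : C → Bool) (t : C → A → C) (x y : C) :
    (∃ (D : Type (max u v)) (o' : D → Bool) (t' : D → A → D) (h : C → D),
        (∀ z : C, o' (h z) = o z) ∧
        (∀ (z : C) (a : A), t' (h z) a = h (t z a)) ∧
        h x = h y) ↔
    lang o t x = lang o t y := by
  constructor
  · rintro ⟨D, o', t', h, ho, ht, hxy⟩
    rw [← lang_map ho ht x, ← lang_map ho ht y, hxy]
  · intro hxy
    exact ⟨ULift.{v} (List A → Bool), fun L => L.down [],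
      fun L a => ⟨fun w => L.down (a :: w)⟩, fun z => ⟨lang o t z⟩,
      fun _ => rfl, fun _ _ => rfl, congrArg ULift.up hxy⟩
end

section
/- Let M be an additive commutative monoid, C a finite type, c : C → (C →₀ M) a weighted transition system, and s : Setoid C an equivalence relation on C. Then the following are equivalent: (i) s is a weighted bisimulation, i.e., for all x y : C with s.r x y and every z : C, ∑_{z' : C, s.r z z'} (c x) z' = ∑_{z' : C, s.r z z'} (c y) z'; (ii) for all x y : C with s.r x y, Finsupp.mapDomain (Quotient.mk s) (c x) = Finsupp.mapDomain (Quotient.mk s) (c y). -/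
open scoped Classical

theorem Finsupp.mapDomain_quotientMk_apply {M : Type*} [AddCommMonoid M] {C : Type*} [Fintype C]
    (s : Setoid C) (f : C →₀ M) (z : C) :
    Finsupp.mapDomain (Quotient.mk s) f (Quotient.mk s z) =
      ∑ z' ∈ Finset.univ.filter (fun z' : C => s.r z z'), f z' := by
  rw [Finsupp.mapDomain_apply_eq_sum]
  refine Finset.sum_subset_zero_on_sdiff (fun z' hz' => ?_) (fun z' hz' => ?_) (fun _ _ => rfl)
  · simp only [Finset.mem_filter, Finset.mem_univ, true_and] at hz' ⊢
    exact s.symm (Quotient.exact hz'.2)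
  · simp only [Finset.mem_sdiff, Finset.mem_filter, Finset.mem_univ, true_and, not_and] at hz'
    exact Finsupp.notMem_support_iff.mp fun h => hz'.2 h (Quotient.sound (s.symm hz'.1))

theorem weighted_bisimulation_iff_mapDomain_stable
    {M : Type*} [AddCommMonoid M] {C : Type*} [Fintype C]
    (c : C → (C →₀ M)) (s : Setoid C) :
    (∀ x y : C, s.r x y → ∀ z : C,
        ∑ z' ∈ Finset.univ.filter (fun z' : C => s.r z z'), (c x) z' =
        ∑ z' ∈ Finset.univ.filter (fun z' : C => s.r z z'), (c y) z') ↔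
    (∀ x y : C, s.r x y →
        Finsupp.mapDomain (Quotient.mk s) (c x) =
        Finsupp.mapDomain (Quotient.mk s) (c y)) := by
  simp only [Finsupp.ext_iff, Quotient.forall, Finsupp.mapDomain_quotientMk_apply]
end
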